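/- Every feasible solution H to the VC-SNDP instance on G' contains all edges of G' incident to the three terminals s, t₁, t₂. Moreover, every feasible solution contains K pairwise vertex-disjoint horizontal paths P₁,…,P_K none of which contains t₂ or any vertex of V_(t), and K pairwise vertex-disjoint vertical paths Q₁,…,Q_K none of which contains t₁ or any vertex of V_(l). -/

import Mathlib

open SimpleGraph

/-- A family of `n` distinct pairwise internally vertex-disjoint `s`-`t` paths:
any two of them only share the vertices `s` and `t`. -/
def IntDisjPaths {V : Type*} (G : SimpleGraph V) (s t : V) (n : ℕ)
    (P : Fin n → G.Walk s t) : Prop :=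
  (∀ i, (P i).IsPath) ∧ ∀ i j, i ≠ j → P i ≠ P j ∧
    ∀ v, v ∈ (P i).support → v ∈ (P j).support → v = s ∨ v = t

/-- The vertex-connectivity `κ_G(s,t)`: the maximum number of pairwise
internally vertex-disjoint `s`-`t` paths. -/
noncomputable def vConn {V : Type*} (G : SimpleGraph V) (s t : V) : ℕ :=
  sSup {n | ∃ P : Fin n → G.Walk s t, IntDisjPaths G s t n P}

/-- The Grid Tiling instance with `K × K` cells and alphabet `[n] × [n]` is a
YES-instance: one can choose a pair in every cell such that horizontally
adjacent choices agree in the first coordinate and vertically adjacent choices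
agree in the second coordinate. -/
def GridTilingYes {K n : ℕ} (S : Fin K → Fin K → Set (Fin n × Fin n)) : Prop :=
  ∃ f : Fin K → Fin K → Fin n × Fin n,
    (∀ i j, f i j ∈ S i j) ∧
    (∀ (i i' j : Fin K), (i' : ℕ) = (i : ℕ) + 1 → (f i j).1 = (f i' j).1) ∧
    (∀ (i j j' : Fin K), (j' : ℕ) = (j : ℕ) + 1 → (f i j).2 = (f i j').2)

/-- The vertices of the graph `G'` constructed from a Grid Tiling instance:
the cell vertices `v^{i,j}_{(a,b)}` (with `star = false`) and
`v^{*,i,j}_{(a,b)}` (with `star = true`), the boundary vertices of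
`V_(l), V_(r), V_(t), V_(b)`, the source `s`, and the two sinks `t₁, t₂`.
(Cell vertices with `(a,b) ∉ S i j` are present but isolated.) -/
inductive GV (K n : ℕ) : Type where
  | cell (i j : Fin K) (a b : Fin n) (star : Bool)
  | left (i : Fin K)
  | right (i : Fin K)
  | top (j : Fin K)
  | bot (j : Fin K)
  | src
  | t1
  | t2
deriving DecidableEq

/-- The base relation of the edges of `G'` (rows and columns are `0`-indexed
by `Fin K`, so column `1` of the paper is index `0` and column `K` is the
index `j` with `(j : ℕ) + 1 = K`). -/
def gridRel {K n : ℕ} (S : Fin K → Fin K → Set (Fin n × Fin n)) :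
    GV K n → GV K n → Prop
  | GV.cell i j a b st, GV.cell i' j' a' b' st' =>
      -- cell edges
      (st = false ∧ st' = true ∧ i = i' ∧ j = j' ∧ a = a' ∧ b = b' ∧
        (a, b) ∈ S i j) ∨
      -- connector edges
      (st = true ∧ st' = false ∧ (a, b) ∈ S i j ∧ (a', b') ∈ S i' j' ∧
        ((i = i' ∧ (j' : ℕ) = (j : ℕ) + 1 ∧ a = a') ∨
         ((i' : ℕ) = (i : ℕ) + 1 ∧ j = j' ∧ b = b')))
  | GV.left li, GV.cell i j a b st =>
      li = i ∧ (j : ℕ) = 0 ∧ st = false ∧ (a, b) ∈ S i j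
  | GV.top tj, GV.cell i j a b st =>
      (i : ℕ) = 0 ∧ tj = j ∧ st = false ∧ (a, b) ∈ S i j
  | GV.cell i j a b st, GV.right ri =>
      i = ri ∧ (j : ℕ) + 1 = K ∧ st = true ∧ (a, b) ∈ S i j
  | GV.cell i j a b st, GV.bot bj =>
      (i : ℕ) + 1 = K ∧ j = bj ∧ st = true ∧ (a, b) ∈ S i j
  | GV.t1, GV.top _ => True
  | GV.t1, GV.right _ => True
  | GV.t2, GV.left _ => True
  | GV.t2, GV.bot _ => True
  | GV.src, GV.top _ => True
  | GV.src, GV.left _ => True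
  | GV.src, GV.t1 => True
  | GV.src, GV.t2 => True
  | GV.t1, GV.t2 => True
  | _, _ => False

/-- The graph `G'` constructed from the Grid Tiling instance. -/
def gridGraph {K n : ℕ} (S : Fin K → Fin K → Set (Fin n × Fin n)) :
    SimpleGraph (GV K n) :=
  SimpleGraph.fromRel (gridRel S)

/-- A feasible solution to the constructed VC-SNDP instance: a subgraph of `G'`
with `κ_H(s,t₁) ≥ 2K+2` and `κ_H(s,t₂) ≥ 2K+2`. Its cost is its number of
edges, i.e. `H.edgeSet.ncard`. -/
def GridFeasible {K n : ℕ} (S : Fin K → Fin K → Set (Fin n × Fin n))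
    (H : SimpleGraph (GV K n)) : Prop :=
  H ≤ gridGraph S ∧
  2 * K + 2 ≤ vConn H GV.src GV.t1 ∧
  2 * K + 2 ≤ vConn H GV.src GV.t2

/-- A family of `K` pairwise vertex-disjoint horizontal paths in `H`: the
`i`-th path connects the boundary vertex `v_{l,σ(i)}` of `V_(l)` with the
boundary vertex `v_{r,τ(i)}` of `V_(r)`, and none of the paths contains `t₂`
or a vertex of `V_(t)`. -/
def HorizFamily {K n : ℕ} (H : SimpleGraph (GV K n)) (σ τ : Fin K → Fin K)
    (P : ∀ i : Fin K, H.Walk (GV.left (σ i)) (GV.right (τ i))) : Prop :=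
  (∀ i, (P i).IsPath) ∧
  (∀ i j, i ≠ j → ∀ v, v ∈ (P i).support → v ∉ (P j).support) ∧
  (∀ i, ∀ v ∈ (P i).support, v ≠ GV.t2 ∧ ∀ jj : Fin K, v ≠ GV.top jj)

/-- A family of `K` pairwise vertex-disjoint vertical paths in `H`: the
`j`-th path connects the boundary vertex `v_{t,σ(j)}` of `V_(t)` with the
boundary vertex `v_{b,τ(j)}` of `V_(b)`, and none of the paths contains `t₁`
or a vertex of `V_(l)`. -/
def VertFamily {K n : ℕ} (H : SimpleGraph (GV K n)) (σ τ : Fin K → Fin K)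
    (Q : ∀ j : Fin K, H.Walk (GV.top (σ j)) (GV.bot (τ j))) : Prop :=
  (∀ j, (Q j).IsPath) ∧
  (∀ i j, i ≠ j → ∀ v, v ∈ (Q i).support → v ∉ (Q j).support) ∧
  (∀ j, ∀ v ∈ (Q j).support, v ≠ GV.t1 ∧ ∀ ii : Fin K, v ≠ GV.left ii)

namespace SimpleGraph

variable {V : Type*} {G : SimpleGraph V} {s t : V}

theorem Walk.IsPath.exists_inner_walk {p : G.Walk s t} (hp : p.IsPath) (hst : s ≠ t)
    {u : V} (hu : p.snd = u) (hut : u ≠ t) :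
    ∃ (v : V) (q : G.Walk u v), q.IsPath ∧ G.Adj v t ∧
      ∀ x ∈ q.support, x ∈ p.support ∧ x ≠ s ∧ x ≠ t := by
  cases p with
  | nil => exact absurd rfl hst
  | cons h p =>
    rw [Walk.snd_cons] at hu
    subst hu
    induction p using Walk.concatRec with
    | Hnil => exact absurd rfl hut
    | Hconcat q h' =>
      rw [Walk.cons_isPath_iff, Walk.concat_isPath_iff] at hp
      refine ⟨_, q, hp.1.1, h', fun x hx => ⟨by simp [hx], ?_, ?_⟩⟩
      · rintro rfl
        exact hp.2 (by simp [hx])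
      · rintro rfl
        exact hp.1.2 hx

end SimpleGraph

namespace IntDisjPaths

variable {V : Type*} {G : SimpleGraph V} {s t : V} {m : ℕ} {P : Fin m → G.Walk s t}

theorem reverse (hP : IntDisjPaths G s t m P) :
    IntDisjPaths G t s m fun i => (P i).reverse := by
  refine ⟨fun i => (hP.1 i).reverse, fun i j hij => ⟨fun h => ?_, fun v hi hj => ?_⟩⟩
  · exact (hP.2 i j hij).1 (Walk.reverse_injective h)
  · rw [Walk.support_reverse, List.mem_reverse] at hi hj
    exact ((hP.2 i j hij).2 v hi hj).symm

theorem snd_injective (hP : IntDisjPaths G s t m P) (hst : s ≠ t) :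
    Function.Injective fun i => (P i).snd := by
  have eq_of_snd : ∀ p : G.Walk s t, p.IsPath → p.snd = t → ∀ q : G.Walk s t, q.IsPath →
      q.snd = t → p = q := by
    intro p hp hpt q hq hqt
    cases p with
    | nil => exact absurd rfl hst
    | cons h p =>
      cases q with
      | nil => exact absurd rfl hst
      | cons h' q =>
        simp only [Walk.snd_cons] at hpt hqt
        subst hpt
        subst hqt
        rw [(Walk.isPath_iff_nil.mp hp.of_cons).eq_nil, (Walk.isPath_iff_nil.mp hq.of_cons).eq_nil]
  intro i j hij
  by_contra hne
  obtain ⟨hPne, hdisj⟩ := hP.2 i j hne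
  have hij' : (P i).snd = (P j).snd := hij
  rcases hdisj (P i).snd (Walk.getVert_mem_support ..)
    (hij' ▸ Walk.getVert_mem_support ..) with h | h
  · exact ((P i).adj_snd (Walk.not_nil_of_ne hst)).ne h.symm
  · exact hPne (eq_of_snd _ (hP.1 i) h _ (hP.1 j) (hij' ▸ h))

/-- If `s` has at most `m` potential neighbours, then `m` internally disjoint paths
leave `s` through every one of them. -/
theorem exists_snd_eq (hP : IntDisjPaths G s t m P) (hst : s ≠ t) {ι : Type*} [Fintype ι]
    (f : ι → V) (hcard : Fintype.card ι ≤ m) (hf : ∀ v, G.Adj s v → ∃ x, f x = v) (x : ι) :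
    ∃ i, (P i).snd = f x := by
  choose g hg using fun i => hf _ ((P i).adj_snd (Walk.not_nil_of_ne hst))
  have hinj : Function.Injective g := fun i j hij =>
    hP.snd_injective hst (by simp only [← hg, hij])
  have hbij : Function.Bijective g := (Fintype.bijective_iff_injective_and_card g).mpr
    ⟨hinj, le_antisymm (Fintype.card_le_of_injective g hinj) (by simpa using hcard)⟩
  obtain ⟨i, rfl⟩ := hbij.2 x
  exact ⟨i, (hg i).symm⟩

theorem adj_of_card_le (hP : IntDisjPaths G s t m P) (hst : s ≠ t) {ι : Type*} [Fintype ι]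
    (f : ι → V) (hcard : Fintype.card ι ≤ m) (hf : ∀ v, G.Adj s v → ∃ x, f x = v) (x : ι) :
    G.Adj s (f x) := by
  obtain ⟨i, hi⟩ := hP.exists_snd_eq hst f hcard hf x
  exact hi ▸ (P i).adj_snd (Walk.not_nil_of_ne hst)

/-- The inner parts of the paths that leave `s` through the vertices `a k` are disjoint,
avoid the other vertices `B` through which paths leave `s`, and end in the neighbours of
`t` outside `B`. -/
theorem exists_disjoint_walks (hP : IntDisjPaths G s t m P) (hst : s ≠ t) {κ μ : Type*}
    (a : κ → V) (b : μ → V) (B : Set V) (ha : Function.Injective a) (hat : ∀ k, a k ≠ t)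
    (hasnd : ∀ k, ∃ i, (P i).snd = a k) (haB : ∀ k, a k ∉ B)
    (hB : ∀ v ∈ B, v ≠ t → ∃ i, (P i).snd = v)
    (hb : ∀ v, G.Adj v t → v = s ∨ v ∈ B ∨ ∃ l, b l = v) :
    ∃ (τ : κ → μ) (W : ∀ k, G.Walk (a k) (b (τ k))), (∀ k, (W k).IsPath) ∧
      (∀ k l, k ≠ l → ∀ v ∈ (W k).support, v ∉ (W l).support) ∧
      ∀ k, ∀ v ∈ (W k).support, v ∉ B := by
  choose idx hidx using hasnd
  have key : ∀ k, ∃ (l : μ) (q : G.Walk (a k) (b l)), q.IsPath ∧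
      ∀ x ∈ q.support, x ∈ (P (idx k)).support ∧ x ≠ s ∧ x ≠ t ∧ x ∉ B := by
    intro k
    obtain ⟨v, q, hq, hv, hsupp⟩ := (hP.1 (idx k)).exists_inner_walk hst (hidx k) (hat k)
    have havoid : ∀ x ∈ q.support, x ∉ B := by
      intro x hx hxB
      obtain ⟨hxP, hxs, hxt⟩ := hsupp x hx
      obtain ⟨j, hj⟩ := hB x hxB hxt
      have hne : idx k ≠ j := by
        rintro rfl
        exact haB k (hidx k ▸ hj ▸ hxB)
      rcases (hP.2 _ _ hne).2 x hxP (hj ▸ Walk.getVert_mem_support ..) with h | h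
      · exact hxs h
      · exact hxt h
    rcases hb v hv with h | h | ⟨l, rfl⟩
    · exact absurd h (hsupp v q.end_mem_support).2.1
    · exact absurd h (havoid v q.end_mem_support)
    · exact ⟨l, q, hq, fun x hx =>
        ⟨(hsupp x hx).1, (hsupp x hx).2.1, (hsupp x hx).2.2, havoid x hx⟩⟩
  choose τ W hW hsupp using key
  refine ⟨τ, W, hW, fun k l hkl v hk hl => ?_, fun k v hv => (hsupp k v hv).2.2.2⟩
  have hne : idx k ≠ idx l := fun h => hkl (ha (by rw [← hidx k, ← hidx l, h]))
  rcases (hP.2 _ _ hne).2 v (hsupp k v hk).1 (hsupp l v hl).1 with h | h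
  · exact (hsupp k v hk).2.1 h
  · exact (hsupp k v hk).2.2.1 h

end IntDisjPaths

theorem exists_intDisjPaths_vConn {V : Type*} {G : SimpleGraph V} {s t : V}
    (h : 0 < vConn G s t) : ∃ P : Fin (vConn G s t) → G.Walk s t, IntDisjPaths G s t _ P := by
  refine Nat.sSup_mem (s := {n | ∃ P : Fin n → G.Walk s t, IntDisjPaths G s t n P}) ?_ ?_ <;>
    by_contra hb
  · rw [Set.not_nonempty_iff_eq_empty] at hb
    simp [vConn, hb] at h
  · exact h.ne' (Nat.sSup_of_not_bddAbove hb)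

namespace GV

variable {K n : ℕ}

/-- The neighbours of `src`. -/
def srcNbr : Fin K ⊕ Fin K ⊕ Bool → GV K n :=
  Sum.elim top (Sum.elim left (Bool.rec t1 t2))

/-- The neighbours of `t1`. -/
def t1Nbr : Fin K ⊕ Fin K ⊕ Bool → GV K n :=
  Sum.elim top (Sum.elim right (Bool.rec src t2))

/-- The neighbours of `t2`. -/
def t2Nbr : Fin K ⊕ Fin K ⊕ Bool → GV K n :=
  Sum.elim left (Sum.elim bot (Bool.rec src t1))

variable {S : Fin K → Fin K → Set (Fin n × Fin n)} {v : GV K n}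

theorem exists_srcNbr_eq (h : (gridGraph S).Adj src v) : ∃ x, srcNbr x = v := by
  cases v <;> simp_all [gridGraph, gridRel, srcNbr]

theorem exists_t1Nbr_eq (h : (gridGraph S).Adj t1 v) : ∃ x, t1Nbr x = v := by
  cases v <;> simp_all [gridGraph, gridRel, t1Nbr]

theorem exists_t2Nbr_eq (h : (gridGraph S).Adj t2 v) : ∃ x, t2Nbr x = v := by
  cases v <;> simp_all [gridGraph, gridRel, t2Nbr]

end GV

/-- Every feasible solution contains all edges of `G'` incident to the three
terminals, contains `K` pairwise vertex-disjoint horizontal paths avoiding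
`t₂` and `V_(t)`, and contains `K` pairwise vertex-disjoint vertical paths
avoiding `t₁` and `V_(l)`. -/
theorem grid_solution_structure {K n : ℕ}
    (S : Fin K → Fin K → Set (Fin n × Fin n))
    (hS : ∀ i j, (S i j).Nonempty)
    (H : SimpleGraph (GV K n)) (hfeas : GridFeasible S H) :
    (∀ v, (gridGraph S).Adj GV.src v → H.Adj GV.src v) ∧
    (∀ v, (gridGraph S).Adj GV.t1 v → H.Adj GV.t1 v) ∧
    (∀ v, (gridGraph S).Adj GV.t2 v → H.Adj GV.t2 v) ∧
    (∃ (σ τ : Fin K → Fin K)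
        (P : ∀ i : Fin K, H.Walk (GV.left (σ i)) (GV.right (τ i))),
      HorizFamily H σ τ P) ∧
    (∃ (σ τ : Fin K → Fin K)
        (Q : ∀ j : Fin K, H.Walk (GV.top (σ j)) (GV.bot (τ j))),
      VertFamily H σ τ Q) := by
  obtain ⟨hle, h1, h2⟩ := hfeas
  obtain ⟨P, hP⟩ := exists_intDisjPaths_vConn (Nat.lt_of_lt_of_le (by omega) h1)
  obtain ⟨Q, hQ⟩ := exists_intDisjPaths_vConn (Nat.lt_of_lt_of_le (by omega) h2)
  have hcard : Fintype.card (Fin K ⊕ Fin K ⊕ Bool) = 2 * K + 2 := by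
    simp only [Fintype.card_sum, Fintype.card_fin, Fintype.card_bool]
    omega
  have hsrc : ∀ v, H.Adj GV.src v → ∃ x, GV.srcNbr x = v := fun v h => GV.exists_srcNbr_eq (hle h)
  have ht1 : ∀ v, H.Adj GV.t1 v → ∃ x, GV.t1Nbr x = v := fun v h => GV.exists_t1Nbr_eq (hle h)
  have ht2 : ∀ v, H.Adj GV.t2 v → ∃ x, GV.t2Nbr x = v := fun v h => GV.exists_t2Nbr_eq (hle h)
  have hPsnd := hP.exists_snd_eq (by simp) GV.srcNbr (hcard.trans_le h1) hsrc
  have hQsnd := hQ.exists_snd_eq (by simp) GV.srcNbr (hcard.trans_le h2) hsrc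
  refine ⟨fun v hv => ?_, fun v hv => ?_, fun v hv => ?_, ?_, ?_⟩
  · obtain ⟨x, rfl⟩ := GV.exists_srcNbr_eq hv
    exact hP.adj_of_card_le (by simp) _ (hcard.trans_le h1) hsrc x
  · obtain ⟨x, rfl⟩ := GV.exists_t1Nbr_eq hv
    exact hP.reverse.adj_of_card_le (by simp) _ (hcard.trans_le h1) ht1 x
  · obtain ⟨x, rfl⟩ := GV.exists_t2Nbr_eq hv
    exact hQ.reverse.adj_of_card_le (by simp) _ (hcard.trans_le h2) ht2 x
  · obtain ⟨τ, W, hpath, hdisj, havoid⟩ := hP.exists_disjoint_walks (by simp) GV.left GV.right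
      (insert GV.t2 (Set.range GV.top)) (fun _ _ => GV.left.inj) (by simp)
      (fun k => hPsnd (.inr (.inl k))) (by simp)
      (by
        rintro v (rfl | ⟨j, rfl⟩) -
        exacts [hPsnd (.inr (.inr true)), hPsnd (.inl j)])
      (by
        intro v hv
        obtain ⟨x | x | _ | _, rfl⟩ := ht1 v hv.symm <;> simp [GV.t1Nbr])
    refine ⟨id, τ, W, hpath, hdisj, fun i v hv => ⟨?_, ?_⟩⟩
    · rintro rfl
      exact havoid i _ hv (by simp)
    · rintro j rfl
      exact havoid i _ hv (by simp)
  · obtain ⟨τ, W, hpath, hdisj, havoid⟩ := hQ.exists_disjoint_walks (by simp) GV.top GV.bot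
      (insert GV.t1 (Set.range GV.left)) (fun _ _ => GV.top.inj) (by simp)
      (fun k => hQsnd (.inl k)) (by simp)
      (by
        rintro v (rfl | ⟨j, rfl⟩) -
        exacts [hQsnd (.inr (.inr false)), hQsnd (.inr (.inl j))])
      (by
        intro v hv
        obtain ⟨x | x | _ | _, rfl⟩ := ht2 v hv.symm <;> simp [GV.t2Nbr])
    refine ⟨id, τ, W, hpath, hdisj, fun i v hv => ⟨?_, ?_⟩⟩
    · rintro rfl
      exact havoid i _ hv (by simp)
    · rintro j rfl
      exact havoid i _ hv (by simp)
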